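/- Let I be a closed two-sided ideal of a unital C*-algebra A such that I and A/I are both extremally rich (I extremally rich meaning its minimal unitization is). If A is extremally rich, then every extremal partial isometry in A/I lifts to an extremal partial isometry in A. -/

import Mathlib

/-- A unital C*-algebra `A` is *extremally rich* if the set
`A⁻¹ 𝓔(A) A⁻¹ = {x * u * y : x, y invertible, u an extreme point of the closed unit ball}`
is dense in `A`. -/
def ExtremallyRich (A : Type*) [CStarAlgebra A] : Prop :=
  Dense {a : A | ∃ x u y : A, IsUnit x ∧ IsUnit y ∧
    u ∈ Set.extremePoints ℝ (Metric.closedBall (0 : A) 1) ∧ a = x * u * y}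

/-- The algebraic form of being an extreme point of the unit ball: `u` is a partial isometry whose
defect projections `1 - u u*` and `1 - u* u` are centrally orthogonal. -/
def IsExtremalPartialIsometry {A : Type*} [Ring A] [StarRing A] (u : A) : Prop :=
  u * (star u * u) = u ∧ ∀ c, (1 - u * star u) * c * (1 - star u * u) = 0

section ExtremePoints

open Set Metric

variable {A : Type*} [CStarAlgebra A]

lemma norm_le_one_iff_star_mul_self_le_one [PartialOrder A] [StarOrderedRing A] (a : A) :
    ‖a‖ ≤ 1 ↔ star a * a ≤ 1 := by
  rw [← CStarAlgebra.norm_le_one_iff_of_nonneg _ (star_mul_self_nonneg a),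
    CStarRing.norm_star_mul_self, ← sq, sq_le_one_iff₀ (norm_nonneg a)]

lemma eq_zero_of_star_mul_self_le_zero [PartialOrder A] [StarOrderedRing A] {a : A}
    (h : star a * a ≤ 0) : a = 0 :=
  CStarRing.star_mul_self_eq_zero_iff a |>.mp <| le_antisymm h (star_mul_self_nonneg a)

lemma eq_zero_of_norm_add_sub_le_one {u z : A}
    (hu : u ∈ extremePoints ℝ (closedBall (0 : A) 1))
    (h₁ : ‖u + z‖ ≤ 1) (h₂ : ‖u - z‖ ≤ 1) : z = 0 := by
  have := (mem_extremePoints.mp hu).2 (u + z) (by simpa using h₁) (u - z) (by simpa using h₂)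
    ⟨1 / 2, 1 / 2, by norm_num, by norm_num, by norm_num, by
      rw [← smul_add, add_add_sub_cancel, ← two_smul ℝ u, smul_smul]; norm_num⟩
  simpa using this.1

lemma norm_mul_cfc_star_mul_self_le_one (u : A) (f : ℝ → ℝ) (hf : Continuous f)
    (h : ∀ t ∈ spectrum ℝ (star u * u), ‖t * f t ^ 2‖ ≤ 1) :
    ‖u * cfc f (star u * u)‖ ≤ 1 := by
  have hsa : IsSelfAdjoint (star u * u) := .star_mul_self u
  have key : star (u * cfc f (star u * u)) * (u * cfc f (star u * u)) =
      cfc (fun t : ℝ ↦ t * f t ^ 2) (star u * u) := by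
    rw [star_mul, (cfc_predicate f (star u * u)).star_eq, mul_assoc, ← mul_assoc (star u)]
    nth_rw 2 [← cfc_id' ℝ (star u * u)]
    rw [← cfc_mul .., ← cfc_mul ..]
    congr 1
    ext t
    ring
  rw [← sq_le_one_iff₀ (norm_nonneg _), sq, ← CStarRing.norm_star_mul_self, key]
  exact norm_cfc_le zero_le_one h

lemma spectrum_star_mul_self_mem_Icc {u : A} (hu : ‖u‖ ≤ 1) {t : ℝ}
    (ht : t ∈ spectrum ℝ (star u * u)) : t ∈ Icc (0 : ℝ) 1 := by
  let := CStarAlgebra.spectralOrder A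
  let := CStarAlgebra.spectralOrderedRing A
  refine ⟨spectrum_nonneg_of_nonneg (star_mul_self_nonneg u) ht, ?_⟩
  have h := (norm_le_one_iff_star_mul_self_le_one u).mp hu
  have hsa : IsSelfAdjoint (star u * u) := .star_mul_self u
  exact (le_algebraMap_iff_spectrum_le (r := (1 : ℝ)) (a := star u * u)).mp (by simpa using h) t ht

lemma mul_star_mul_self_of_mem_extremePoints {u : A}
    (hu : u ∈ extremePoints ℝ (closedBall (0 : A) 1)) : u * (star u * u) = u := by
  have hu1 : ‖u‖ ≤ 1 := by simpa using hu.1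
  have hsa : IsSelfAdjoint (star u * u) := .star_mul_self u
  have hz : u * cfc (fun t : ℝ ↦ (1 - t) / 2) (star u * u) = 0 := by
    refine eq_zero_of_norm_add_sub_le_one hu ?_ ?_
    · have : u + u * cfc (fun t : ℝ ↦ (1 - t) / 2) (star u * u) =
          u * cfc (fun t : ℝ ↦ 1 + (1 - t) / 2) (star u * u) := by
        rw [cfc_const_add .., map_one, mul_add, mul_one]
      rw [this]
      refine norm_mul_cfc_star_mul_self_le_one u _ (by fun_prop) fun t ht ↦ ?_
      obtain ⟨h0, h1⟩ := spectrum_star_mul_self_mem_Icc hu1 ht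
      rw [Real.norm_of_nonneg (by positivity)]
      nlinarith [mul_nonneg (sq_nonneg (1 - t)) (by linarith : 0 ≤ 4 - t)]
    · have : u - u * cfc (fun t : ℝ ↦ (1 - t) / 2) (star u * u) =
          u * cfc (fun t : ℝ ↦ 1 - (1 - t) / 2) (star u * u) := by
        rw [cfc_sub .., cfc_const_one .., mul_sub, mul_one]
      rw [this]
      refine norm_mul_cfc_star_mul_self_le_one u _ (by fun_prop) fun t ht ↦ ?_
      obtain ⟨h0, h1⟩ := spectrum_star_mul_self_mem_Icc hu1 ht
      rw [Real.norm_of_nonneg (by positivity)]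
      have : (1 - (1 - t) / 2) ^ 2 ≤ 1 := by nlinarith
      nlinarith
  have hc : cfc (fun t : ℝ ↦ (1 - t) / 2) (star u * u) = (1 / 2 : ℝ) • (1 - star u * u) := by
    have : (fun t : ℝ ↦ (1 - t) / 2) = fun t : ℝ ↦ (1 / 2 : ℝ) * (1 - t) := by ext t; ring
    rw [this, cfc_const_mul .., cfc_sub .., cfc_const_one .., cfc_id' ..]
  rw [hc, mul_smul_comm, smul_eq_zero] at hz
  have := hz.resolve_left (by norm_num)
  rw [mul_sub, mul_one, sub_eq_zero] at this
  exact this.symm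

lemma IsExtremalPartialIsometry.of_mem_extremePoints {u : A}
    (hu : u ∈ extremePoints ℝ (closedBall (0 : A) 1)) : IsExtremalPartialIsometry u := by
  let := CStarAlgebra.spectralOrder A
  let := CStarAlgebra.spectralOrderedRing A
  have hpi := mul_star_mul_self_of_mem_extremePoints hu
  refine ⟨hpi, fun c ↦ ?_⟩
  have hpi' : star u * u * star u = star u := by simpa [mul_assoc] using congr(star $hpi)
  have small : ∀ c : A, ‖(1 - u * star u) * c * (1 - star u * u)‖ ≤ 1 →
      (1 - u * star u) * c * (1 - star u * u) = 0 := by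
    intro c hc
    set z := (1 - u * star u) * c * (1 - star u * u) with hz
    have huz : star u * z = 0 := by
      have : star u * (1 - u * star u) = 0 := by
        rw [mul_sub, mul_one, ← mul_assoc, hpi', sub_self]
      rw [hz, ← mul_assoc, ← mul_assoc, this, zero_mul, zero_mul]
    have hzu : star z * u = 0 := by simpa using congr(star $huz)
    have hff : (star u * u) * (star u * u) = star u * u := by rw [mul_assoc, hpi]
    have hzf : z * (1 - star u * u) = z := by
      rw [hz, mul_assoc _ (1 - star u * u), IsIdempotentElem.one_sub hff]
    have hsf : star (1 - star u * u) = 1 - star u * u := by simp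
    have hzle : star z * z ≤ 1 - star u * u := by
      have := star_left_conjugate_le_conjugate
        ((norm_le_one_iff_star_mul_self_le_one z).mp hc) (1 - star u * u)
      calc star z * z = star (z * (1 - star u * u)) * (z * (1 - star u * u)) := by rw [hzf]
        _ = star (1 - star u * u) * (star z * z) * (1 - star u * u) := by
          rw [star_mul]; simp only [mul_assoc]
        _ ≤ _ := this
        _ = 1 - star u * u := by
          rw [hsf, mul_one, mul_sub, mul_one, sub_mul, one_mul, hff, sub_self, sub_zero]
    refine eq_zero_of_norm_add_sub_le_one hu ?_ ?_ <;>
      rw [norm_le_one_iff_star_mul_self_le_one]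
    · calc star (u + z) * (u + z) = star u * u + star z * z := by
            simp only [star_add, add_mul, mul_add, huz, hzu]; abel
        _ ≤ star u * u + (1 - star u * u) := by gcongr
        _ = 1 := by abel
    · calc star (u - z) * (u - z) = star u * u + star z * z := by
            simp only [star_sub, sub_mul, mul_sub, huz, hzu]; abel
        _ ≤ star u * u + (1 - star u * u) := by gcongr
        _ = 1 := by abel
  set z := (1 - u * star u) * c * (1 - star u * u) with hz
  have := small ((‖z‖ + 1)⁻¹ • c) (by
    rw [mul_smul_comm, smul_mul_assoc, ← hz, norm_smul, norm_inv, Real.norm_of_nonneg (by positivity),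
      inv_mul_le_iff₀ (by positivity)]
    linarith)
  rw [mul_smul_comm, smul_mul_assoc, ← hz, smul_eq_zero] at this
  exact this.resolve_left (by positivity)

lemma IsExtremalPartialIsometry.mem_extremePoints {w : A} (hw : IsExtremalPartialIsometry w) :
    w ∈ extremePoints ℝ (closedBall (0 : A) 1) := by
  let := CStarAlgebra.spectralOrder A
  let := CStarAlgebra.spectralOrderedRing A
  obtain ⟨hpi, hdef⟩ := hw
  have hpi' : star w * w * star w = star w := by simpa [mul_assoc] using congr(star $hpi)
  have hff : (star w * w) * (star w * w) = star w * w := by rw [mul_assoc, hpi]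
  have hproj : IsStarProjection (star w * w) := ⟨hff, .star_mul_self w⟩
  have hle : star w * w ≤ 1 := hproj.le_one
  have convex : ∀ (x y v : A) (s t : ℝ), 0 < s → 0 < t → s + t = 1 → s • x + t • y = v →
      star x * x ≤ 1 → star y * y ≤ 1 → v * (star v * v) = v →
      (x - y) * (star v * v) = 0 := by
    intro x y v s t hs ht hst hv hx hy hpi
    have hff : (star v * v) * (star v * v) = star v * v := by rw [mul_assoc, hpi]
    have h1 : (s * t) • (star (x - y) * (x - y)) ≤ 1 - star v * v := by
      have h2 : (s * t) • (star (x - y) * (x - y)) =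
          s • (star x * x) + t • (star y * y) - star v * v := by
        obtain rfl : t = 1 - s := by linarith
        subst hv
        simp only [star_add, star_sub, star_smul, star_trivial, mul_add, add_mul, mul_sub, sub_mul,
          smul_mul_assoc, mul_smul_comm]
        match_scalars <;> ring
      rw [h2]
      have h3 : s • (star x * x) + t • (star y * y) ≤ s • (1 : A) + t • (1 : A) := by gcongr
      rw [← add_smul, hst, one_smul] at h3
      gcongr
    have h4 := star_left_conjugate_le_conjugate h1 (star v * v)
    have h5 : star (star v * v) = star v * v := by simp
    rw [h5] at h4
    have h6 : star v * v * (1 - star v * v) * (star v * v) = 0 := by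
      rw [mul_sub, mul_one, hff, sub_self, zero_mul]
    rw [h6] at h4
    have h7 : star v * v * ((s * t) • (star (x - y) * (x - y))) * (star v * v) =
        (s * t) • (star ((x - y) * (star v * v)) * ((x - y) * (star v * v))) := by
      rw [star_mul, h5, mul_smul_comm, smul_mul_assoc]; simp only [mul_assoc]
    rw [h7] at h4
    have hst0 : 0 < s * t := by positivity
    refine eq_zero_of_star_mul_self_le_zero ?_
    have := smul_le_smul_of_nonneg_left h4 (inv_nonneg.mpr hst0.le)
    rwa [smul_smul, inv_mul_cancel₀ hst0.ne', one_smul, smul_zero] at this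
  refine mem_extremePoints_iff_left.mpr ⟨?_, fun x hx y hy ⟨s, t, hs, ht, hst, hxy⟩ ↦ ?_⟩
  · simpa using (norm_le_one_iff_star_mul_self_le_one w).mpr hle
  have hx' : ‖x‖ ≤ 1 := by simpa using hx
  have hy' : ‖y‖ ≤ 1 := by simpa using hy
  have hr : (x - y) * (star w * w) = 0 :=
    convex x y w s t hs ht hst hxy ((norm_le_one_iff_star_mul_self_le_one x).mp hx')
      ((norm_le_one_iff_star_mul_self_le_one y).mp hy') hpi
  have hl : (star x - star y) * (star (star w) * star w) = 0 :=
    convex (star x) (star y) (star w) s t hs ht hst (by simp [← hxy])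
      ((norm_le_one_iff_star_mul_self_le_one _).mp (by simpa using hx'))
      ((norm_le_one_iff_star_mul_self_le_one _).mp (by simpa using hy'))
      (by simpa [mul_assoc] using hpi')
  have hl' : w * star w * (x - y) = 0 := by simpa [mul_assoc] using congr(star $hl)
  have hxy0 : x - y = 0 := by
    have := hdef (x - y)
    rwa [sub_mul, one_mul, hl', sub_zero, mul_sub, mul_one, hr, sub_zero] at this
  rw [sub_eq_zero] at hxy0
  subst hxy0
  rwa [← add_smul, hst, one_smul] at hxy

lemma IsExtremalPartialIsometry.unit_mul_mul_unit {v x y : A} (hv : IsExtremalPartialIsometry v)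
    (hx : IsUnit x) (hy : IsUnit y)
    (hw : (x * v * y) * (star (x * v * y) * (x * v * y)) = x * v * y) :
    IsExtremalPartialIsometry (x * v * y) := by
  refine ⟨hw, fun c ↦ ?_⟩
  obtain ⟨x, rfl⟩ := hx
  obtain ⟨y, rfl⟩ := hy
  set w := (x : A) * v * y with hw_def
  have h1 : v * (y * (1 - star w * w)) = 0 := by
    have : w * (1 - star w * w) = 0 := by rw [mul_sub, mul_one, hw, sub_self]
    rw [hw_def, mul_assoc, mul_assoc, Units.mul_right_eq_zero] at this
    exact this
  have h2 : (1 - w * star w) * x * v = 0 := by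
    have : (1 - w * star w) * w = 0 := by rw [sub_mul, one_mul, mul_assoc, hw, sub_self]
    nth_rw 3 [hw_def] at this
    rwa [← mul_assoc, ← mul_assoc, Units.mul_left_eq_zero] at this
  have h3 : (1 - w * star w) * x = (1 - w * star w) * x * (1 - v * star v) := by
    rw [mul_sub, mul_one, ← mul_assoc, h2, zero_mul, sub_zero]
  have h4 : y * (1 - star w * w) = (1 - star v * v) * (y * (1 - star w * w)) := by
    rw [sub_mul, one_mul, mul_assoc, h1, mul_zero, sub_zero]
  calc (1 - w * star w) * c * (1 - star w * w)
      = ((1 - w * star w) * x) * (x⁻¹ * c * y⁻¹) * (y * (1 - star w * w)) := by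
        simp [mul_assoc]
    _ = (1 - w * star w) * x * ((1 - v * star v) * (x⁻¹ * c * y⁻¹) * (1 - star v * v)) *
          (y * (1 - star w * w)) := by
        nth_rw 1 [h3, h4]; simp only [mul_assoc]
    _ = 0 := by rw [hv.2, mul_zero, zero_mul]

end ExtremePoints

section PolarDecomposition

variable {A : Type*} [CStarAlgebra A]

/-- If `a` is von Neumann regular, then zero is isolated in the spectrum of `a* a`. -/
lemma exists_spectrum_star_mul_self_gap {a s : A} (h : a * s * a = a) :
    ∃ δ : ℝ, 0 < δ ∧ δ ≤ 1 ∧ ∀ t ∈ spectrum ℝ (star a * a), t = 0 ∨ δ ≤ t := by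
  let := CStarAlgebra.spectralOrder A
  let := CStarAlgebra.spectralOrderedRing A
  set d := star a * a with hd
  have hsa : IsSelfAdjoint d := .star_mul_self a
  have hd0 : 0 ≤ d := star_mul_self_nonneg a
  set M := ‖s * star s‖ with hM
  have hle : d ≤ M • (d * d) := by
    have h1 := CStarAlgebra.star_left_conjugate_le_norm_smul (a := d) (b := s * star s)
      (.mul_star_self s)
    rw [hsa.star_eq] at h1
    refine le_trans ?_ h1
    have h2 : d * s * a = d := by
      rw [hd, mul_assoc, mul_assoc, ← mul_assoc a, h]
    have h3 : star a * star s * d = d := by simpa [mul_assoc, hsa.star_eq] using congr(star $h2)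
    have h4 : star (star s * d - a) * (star s * d - a) = d * (s * star s) * d - d := by
      have : star (star s * d - a) * (star s * d - a) =
          d * (s * star s) * d - d * s * a - star a * star s * d + d := by
        simp only [star_sub, star_mul, star_star, hsa.star_eq, sub_mul, mul_sub, mul_assoc, ← hd]
        abel
      rw [this, h2, h3]
      abel
    rw [← sub_nonneg, ← h4]
    exact star_mul_self_nonneg _
  have hcfc : 0 ≤ cfc (fun t : ℝ ↦ M * (t * t) - t) d := by
    rw [cfc_sub .., cfc_const_mul .., cfc_mul .., cfc_id' ..]
    exact sub_nonneg.mpr hle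
  have hsp := (cfc_nonneg_iff _ d).mp hcfc
  have hM0 : 0 ≤ M := norm_nonneg _
  refine ⟨(M + 1)⁻¹, by positivity, inv_le_one_of_one_le₀ (by linarith), fun t ht ↦ ?_⟩
  rcases (spectrum_nonneg_of_nonneg hd0 ht).eq_or_lt with h0 | h0
  · exact .inl h0.symm
  · right
    have := hsp t ht
    rw [inv_le_iff_one_le_mul₀' (by positivity)]
    by_contra! hlt
    nlinarith [mul_pos h0 (sub_pos.mpr hlt), mul_pos h0 h0]

/-- A von Neumann regular element becomes a partial isometry after right multiplication by an
invertible element `cfc k (a* a)`; `k` can be chosen with `k 1 = 1`. -/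
lemma exists_cfc_isUnit_mul_partialIsometry {a s : A} (h : a * s * a = a) :
    ∃ k : ℝ → ℝ, Continuous k ∧ k 1 = 1 ∧ IsUnit (cfc k (star a * a)) ∧
      (a * cfc k (star a * a)) *
        (star (a * cfc k (star a * a)) * (a * cfc k (star a * a))) = a * cfc k (star a * a) := by
  obtain ⟨δ, hδ, hδ1, hsp⟩ := exists_spectrum_star_mul_self_gap h
  have hsa : IsSelfAdjoint (star a * a) := .star_mul_self a
  obtain ⟨k, hk, hk1, hk0, hkδ⟩ : ∃ k : ℝ → ℝ, Continuous k ∧ k 1 = 1 ∧ (∀ t, k t ≠ 0) ∧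
      ∀ t, δ ≤ t → t * (k t * t * k t) = t := by
    have hpos (t : ℝ) : 0 < √(max t δ) := Real.sqrt_pos.mpr (lt_max_of_lt_right hδ)
    refine ⟨fun t ↦ (√(max t δ))⁻¹, ?_, by simp [hδ1], fun t ↦ (inv_pos.mpr (hpos t)).ne',
      fun t ht ↦ ?_⟩
    · exact Continuous.inv₀ (by fun_prop) fun t ↦ (hpos t).ne'
    · have ht0 : 0 < t := hδ.trans_le ht
      have := Real.sqrt_pos.mpr ht0
      simp only [max_eq_left ht]
      field_simp
      rw [Real.sq_sqrt ht0.le]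
  refine ⟨k, hk, hk1, (isUnit_cfc_iff k _ hk.continuousOn).mpr fun t _ ↦ hk0 t, ?_⟩
  set d := star a * a with hd
  set K := cfc k d with hK
  have hKd : K * d * K = cfc (fun t ↦ k t * t * k t) d := by
    rw [cfc_mul .., cfc_mul .., cfc_id' ..]
  have hdP : d * (K * d * K) = d := by
    rw [hKd]
    nth_rw 1 [← cfc_id' ℝ d]
    rw [← cfc_mul ..]
    nth_rw 2 [← cfc_id' ℝ d]
    refine cfc_congr fun t ht ↦ ?_
    rcases hsp t ht with rfl | h
    · simp
    · exact hkδ t h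
  have haP : a * (1 - K * d * K) = 0 := by
    rw [← CStarRing.star_mul_self_eq_zero_iff, star_mul, mul_assoc, ← mul_assoc (star a), ← hd,
      mul_sub, mul_one, hdP, sub_self, mul_zero]
  have haP' : a * (K * d * K) = a := by
    rw [mul_sub, mul_one, sub_eq_zero] at haP; exact haP.symm
  have hcomm : K * (K * d * K) = (K * d * K) * K := by
    rw [hKd, hK]; exact (cfc_commute_cfc ..)
  have hKsa : star K = K := (cfc_predicate (R := ℝ) _ d).star_eq
  calc a * K * (star (a * K) * (a * K)) = a * (K * (K * d * K)) := by
        rw [star_mul, hKsa, hd]; simp only [mul_assoc]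
    _ = a * K := by rw [hcomm, ← mul_assoc, haP']

end PolarDecomposition

section Lifting

/-- Elements `b` near an extremal partial isometry `u` factor as `b = X u Y`, with `X` and `Y`
invertible. -/
lemma IsExtremalPartialIsometry.eq_mul_mul {B : Type*} [Ring B] [StarRing B] {u b y : B}
    (hu : IsExtremalPartialIsometry u) (hy : y * (1 + star u * (b - u)) = 1) :
    b = (1 + (1 - u * star u) * b * y * star u) * u * (1 + star u * (b - u)) := by
  obtain ⟨hpi, hdef⟩ := hu
  have hpi' : star u * u * star u = star u := by simpa [mul_assoc] using congr(star $hpi)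
  set Y := 1 + star u * (b - u) with hY
  have huY : u * Y = u * star u * b := by
    rw [hY, mul_add, mul_one, mul_sub, mul_sub, hpi, mul_assoc]; abel
  have hfY : (1 - star u * u) * Y = 1 - star u * u := by
    rw [hY, mul_add, mul_one, ← mul_assoc, sub_mul 1 _ (star u), one_mul, hpi', sub_self, zero_mul,
      add_zero]
  have h1 : (1 - u * star u) * b * y * (star u * u * Y) = (1 - u * star u) * b := by
    have h2 : star u * u * Y = Y - (1 - star u * u) := by
      rw [← hfY, sub_mul, one_mul, sub_sub_cancel]
    rw [h2, mul_sub, mul_assoc _ y Y, hy, mul_one, mul_assoc _ b y, hdef, sub_zero]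
  calc b = u * star u * b + (1 - u * star u) * b := by rw [sub_mul, one_mul]; abel
    _ = u * Y + (1 - u * star u) * b * y * (star u * u * Y) := by rw [huY, h1]
    _ = _ := by rw [add_mul, add_mul, one_mul]; simp only [mul_assoc]

lemma one_add_smul_pow_of_mul_self_eq_zero {B : Type*} [Ring B] [Algebra ℂ B] {n : B}
    (hn : n * n = 0) (c : ℂ) (j : ℕ) : (1 + c • n) ^ j = 1 + (j * c) • n := by
  induction j with
  | zero => simp
  | succ j ih =>
    rw [pow_succ, ih, add_mul, mul_add, mul_add, smul_mul_smul_comm, hn, smul_zero, add_zero,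
      one_mul, one_mul, mul_one, add_assoc, ← add_smul]
    push_cast
    ring_nf

/-- If `n² = 0`, then `1 + n` lifts to an invertible element along any surjection. -/
lemma exists_isUnit_map_eq_one_add {A B F : Type*} [NormedRing A] [NormedAlgebra ℂ A]
    [CompleteSpace A] [Ring B] [Algebra ℂ B] [FunLike F A B] [AlgHomClass F ℂ A B] (q : F)
    (hq : Function.Surjective q) {n : B} (hn : n * n = 0) : ∃ x : A, IsUnit x ∧ q x = 1 + n := by
  obtain ⟨m, rfl⟩ := hq n
  obtain ⟨k, hk⟩ := exists_nat_gt ‖m‖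
  have hk0 : (0 : ℝ) < k := (norm_nonneg m).trans_lt hk
  refine ⟨(1 + (k : ℂ)⁻¹ • m) ^ k, IsUnit.pow _ ?_, ?_⟩
  · rw [← sub_neg_eq_add]
    refine isUnit_one_sub_of_norm_lt_one ?_
    rw [norm_neg, norm_smul, norm_inv, Complex.norm_natCast, inv_mul_lt_iff₀ hk0, mul_one]
    exact hk
  · have hk0' : (k : ℂ) ≠ 0 := by exact_mod_cast hk0.ne'
    rw [map_pow, map_add, map_one, map_smul, one_add_smul_pow_of_mul_self_eq_zero hn,
      mul_inv_cancel₀ hk0', one_smul]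

/-- In an extremally rich algebra, an extremal partial isometry of a quotient lifts to
an element of `A⁻¹ 𝓔(A) A⁻¹`. -/
lemma ExtremallyRich.exists_quasiInvertible_lift {A B : Type*} [CStarAlgebra A] [CStarAlgebra B]
    (hA : ExtremallyRich A) (q : A →⋆ₐ[ℂ] B) (hq : Function.Surjective q) {u : B}
    (hu : IsExtremalPartialIsometry u) :
    ∃ x v y : A, IsUnit x ∧ IsUnit y ∧ IsExtremalPartialIsometry v ∧ q (x * v * y) = u := by
  obtain ⟨u₀, rfl⟩ := hq u
  have hopen : IsOpen {a : A | IsUnit (1 + star u₀ * (a - u₀))} :=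
    Units.isOpen.preimage (f := fun a ↦ 1 + star u₀ * (a - u₀)) (by fun_prop)
  obtain ⟨a, hY, x, v, y, hx, hy, hv, rfl⟩ :=
    hA.inter_open_nonempty _ hopen ⟨u₀, by simp⟩
  obtain ⟨Y, hY⟩ := hY
  have hqY : q Y = 1 + star (q u₀) * (q (x * v * y) - q u₀) := by
    simp [hY, map_star]
  have hfac := hu.eq_mul_mul (b := q (x * v * y)) (y := q ↑Y⁻¹)
    (by rw [← hqY, ← map_mul, Units.inv_mul, map_one])
  have hpi' : star (q u₀) * q u₀ * star (q u₀) = star (q u₀) := by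
    simpa [mul_assoc] using congr(star $(hu.1))
  set n := (1 - q u₀ * star (q u₀)) * q (x * v * y) * q ↑Y⁻¹ * star (q u₀) with hn
  have hnn : n * n = 0 := by
    have : star (q u₀) * (1 - q u₀ * star (q u₀)) = 0 := by
      rw [mul_sub, mul_one, ← mul_assoc, hpi', sub_self]
    have h : star (q u₀) * n = 0 := by
      simp only [hn, ← mul_assoc, this, zero_mul]
    nth_rw 1 [hn]
    rw [mul_assoc, h, mul_zero]
  obtain ⟨_, ⟨X, rfl⟩, hX⟩ := exists_isUnit_map_eq_one_add q hq hnn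
  rw [← hX, ← hqY] at hfac
  refine ⟨↑X⁻¹ * x, v, y * ↑Y⁻¹, (X⁻¹).isUnit.mul hx, hy.mul (Y⁻¹).isUnit,
    .of_mem_extremePoints hv, ?_⟩
  calc q (↑X⁻¹ * x * v * (y * ↑Y⁻¹)) = q ↑X⁻¹ * q (x * v * y) * q ↑Y⁻¹ := by
        simp only [map_mul, mul_assoc]
    _ = q (↑X⁻¹ * X) * q u₀ * q (Y * ↑Y⁻¹) := by
        rw [hfac]; simp only [map_mul, mul_assoc]
    _ = q u₀ := by simp

/-- For a partial isometry `u` and `k 1 = 1`, the element `u k(u* u)` is `u` itself. -/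
lemma mul_cfc_star_mul_self_of_partialIsometry {B : Type*} [CStarAlgebra B] {u : B}
    (hu : u * (star u * u) = u) {k : ℝ → ℝ} (hk : Continuous k) (hk1 : k 1 = 1) :
    u * cfc k (star u * u) = u := by
  have hsa : IsSelfAdjoint (star u * u) := .star_mul_self u
  have hff : IsIdempotentElem (star u * u) := by
    rw [IsIdempotentElem, mul_assoc, hu]
  have h : star u * u * cfc k (star u * u) = star u * u := by
    nth_rw 1 [← cfc_id' ℝ (star u * u)]
    rw [← cfc_mul ..]
    nth_rw 2 [← cfc_id' ℝ (star u * u)]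
    refine cfc_congr fun t ht ↦ ?_
    rcases hff.spectrum_subset ℝ ht with rfl | rfl <;> simp [hk1]
  calc u * cfc k (star u * u) = u * (star u * u * cfc k (star u * u)) := by
        rw [← mul_assoc, hu]
    _ = u := by rw [h, hu]

open scoped CStarAlgebra in
lemma map_cfc_star_mul_self {A B : Type*} [CStarAlgebra A] [CStarAlgebra B] (q : A →⋆ₐ[ℂ] B)
    (a : A) {k : ℝ → ℝ} (hk : Continuous k) :
    q (cfc k (star a * a)) = cfc k (star (q a) * q a) := by
  have hsa : IsSelfAdjoint (star a * a) := .star_mul_self a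
  have hsa' : IsSelfAdjoint (star (q a) * q a) := .star_mul_self _
  have hmap : q (star a * a) = star (q a) * q a := by rw [map_mul, map_star]
  have hcont : Continuous q := map_continuous q
  rw [StarAlgHomClass.map_cfc (S := ℂ) q k _ hk.continuousOn hcont hsa (hmap ▸ hsa'), hmap]

end Lifting

/-- Let `I` be a closed two-sided ideal of a unital C*-algebra `A`
(realized by the isometric embedding `ι : I → A`), and let `q : A → B` realize the quotient
`B = A/I`.  Suppose `I` is extremally rich (meaning its minimal unitization is) and `B` is
extremally rich.  If `A` is extremally rich, then every extremal partial isometry (extreme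
point of the closed unit ball) in `A/I` lifts to an extremal partial isometry in `A`. -/
theorem stmt4 {I A B : Type*} [NonUnitalCStarAlgebra I] [CStarAlgebra A] [CStarAlgebra B]
    (ι : I →⋆ₙₐ[ℂ] A) (hιisom : Isometry ι)
    (hideal : ∀ (a : A) (x : I), a * ι x ∈ Set.range ι ∧ ι x * a ∈ Set.range ι)
    (q : A →⋆ₐ[ℂ] B) (hqsurj : Function.Surjective q)
    (hker : ∀ a : A, q a = 0 ↔ a ∈ Set.range ι)
    (hI : ExtremallyRich (Unitization ℂ I))
    (hB : ExtremallyRich B)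
    (hA : ExtremallyRich A) :
    ∀ u ∈ Set.extremePoints ℝ (Metric.closedBall (0 : B) 1),
      ∃ v ∈ Set.extremePoints ℝ (Metric.closedBall (0 : A) 1), q v = u := by
  intro u hu
  have hu' := IsExtremalPartialIsometry.of_mem_extremePoints hu
  obtain ⟨x, v, y, hx, hy, hv, hq⟩ := hA.exists_quasiInvertible_lift q hqsurj hu'
  have hreg : x * v * y * (Ring.inverse y * star v * Ring.inverse x) * (x * v * y) = x * v * y := by
    obtain ⟨x, rfl⟩ := hx
    obtain ⟨y, rfl⟩ := hy
    simpa [mul_assoc] using congr($(hv.1) * (y : A))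
  obtain ⟨k, hk, hk1, hkunit, hw⟩ := exists_cfc_isUnit_mul_partialIsometry hreg
  refine ⟨x * v * y * cfc k (star (x * v * y) * (x * v * y)), ?_, ?_⟩
  · rw [mul_assoc (x * v) y] at hw ⊢
    exact (hv.unit_mul_mul_unit hx (hy.mul hkunit) hw).mem_extremePoints
  · have hmap : q (cfc k (star (x * v * y) * (x * v * y))) = cfc k (star u * u) := by
      rw [map_cfc_star_mul_self q _ hk, hq]
    rw [map_mul, hq, hmap, mul_cfc_star_mul_self_of_partialIsometry hu'.1 hk hk1]
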